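/- arXiv:2312.12517 — 2 statements merged into one kernel-verified Lean document; each statement's English description precedes it below -/
import Mathlib

section
/- Restriction to the Cauchy surface {t = 0} is a bijection from the set of pairs of smooth time-dependent vector fields (E, B) on ℝ × ℝ³ satisfying the vacuum Maxwell equations (div B = 0, div E = 0, ∂_tB = −curl E, ∂_tE = curl B at every point) onto the set of pairs of smooth vector fields (E₀, B₀) on ℝ³ satisfying (only) the Gauß constraints div E₀ = 0 and div B₀ = 0. (Theorem 2.2 of the paper — the canonical solution space of a higher gauge theory is the space of flux densities on a Cauchy surface subject only to the Gauß law — instantiated for vacuum Maxwell theory on 4d Minkowski spacetime.) -/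
open scoped BigOperators

/-- `ℝ³`. -/
abbrev V3 : Type := Fin 3 → ℝ

/-- Time derivative `∂ₜV` of a time-dependent vector field on `ℝ³` (slicewise in `t`). -/
noncomputable def tdVec (V : ℝ × V3 → V3) (q : ℝ × V3) : V3 :=
  deriv (fun s : ℝ => V (s, q.2)) q.1

/-- Spatial partial derivative `∂ᵢf` of a time-dependent scalar field (slicewise in `t`). -/
noncomputable def pd (i : Fin 3) (f : ℝ × V3 → ℝ) (q : ℝ × V3) : ℝ :=
  fderiv ℝ (fun x : V3 => f (q.1, x)) q.2 (Pi.single i 1)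

/-- Divergence `div V = ∂₁V₁ + ∂₂V₂ + ∂₃V₃`, computed slicewise in `t`. -/
noncomputable def div3 (V : ℝ × V3 → V3) (q : ℝ × V3) : ℝ :=
  ∑ i : Fin 3, pd i (fun q' => V q' i) q

/-- Curl `curl V = (∂₂V₃ − ∂₃V₂, ∂₃V₁ − ∂₁V₃, ∂₁V₂ − ∂₂V₁)`, computed slicewise in `t`. -/
noncomputable def curl3 (V : ℝ × V3 → V3) (q : ℝ × V3) : V3 :=
  ![pd 1 (fun q' => V q' 2) q - pd 2 (fun q' => V q' 1) q,
    pd 2 (fun q' => V q' 0) q - pd 0 (fun q' => V q' 2) q,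
    pd 0 (fun q' => V q' 1) q - pd 1 (fun q' => V q' 0) q]

/-- Spatial partial derivative of a scalar field on `ℝ³`. -/
noncomputable def pd0 (i : Fin 3) (f : V3 → ℝ) (x : V3) : ℝ :=
  fderiv ℝ f x (Pi.single i 1)

/-- Divergence of a vector field on `ℝ³`. -/
noncomputable def div30 (V : V3 → V3) (x : V3) : ℝ :=
  ∑ i : Fin 3, pd0 i (fun x' => V x' i) x

open scoped ContDiff

namespace Maxwell

section Calculus

variable {E F : Type} [NormedAddCommGroup E] [NormedSpace ℝ E]
  [NormedAddCommGroup F] [NormedSpace ℝ F]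

/-- The derivative of `f` in the direction `v`. -/
noncomputable def dd (v : E) (f : E → F) (x : E) : F := fderiv ℝ f x v

theorem differentiable {f : E → F} (hf : ContDiff ℝ ∞ f) : Differentiable ℝ f :=
  hf.differentiable (by simp)

theorem contDiff_dd {f : E → F} (hf : ContDiff ℝ ∞ f) (v : E) : ContDiff ℝ ∞ (dd v f) :=
  (hf.fderiv_right (m := ∞) (by simp)).clm_apply contDiff_const

theorem dd_comm {f : E → F} (hf : ContDiff ℝ ∞ f) (v w : E) :
    dd v (dd w f) = dd w (dd v f) := by
  have key (a b : E) (x : E) : dd a (dd b f) x = fderiv ℝ (fderiv ℝ f) x a b := by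
    have h := differentiable (hf.fderiv_right (m := ∞) (by simp)) x
    unfold dd
    rw [fderiv_clm_apply h (by fun_prop)]
    simp
  funext x
  rw [key, key]
  exact hf.contDiffAt.isSymmSndFDerivAt (by
    rw [minSmoothness_of_isRCLikeNormedField]
    exact WithTop.coe_le_coe.2 (le_top : (2 : ℕ∞) ≤ ⊤)) v w

theorem dd_add_fun {f g : E → F} (hf : ContDiff ℝ ∞ f) (hg : ContDiff ℝ ∞ g) (v : E) :
    dd v (fun x => f x + g x) = fun x => dd v f x + dd v g x := by
  funext x
  simp only [dd]
  rw [fderiv_fun_add (differentiable hf x) (differentiable hg x)]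
  rfl

theorem dd_sub_fun {f g : E → F} (hf : ContDiff ℝ ∞ f) (hg : ContDiff ℝ ∞ g) (v : E) :
    dd v (fun x => f x - g x) = fun x => dd v f x - dd v g x := by
  funext x
  simp only [dd]
  rw [fderiv_fun_sub (differentiable hf x) (differentiable hg x)]
  rfl

theorem dd_neg_fun {f : E → F} (v : E) :
    dd v (fun x => - f x) = fun x => - dd v f x := by
  funext x
  simp only [dd]
  rw [fderiv_fun_neg]
  rfl

theorem dd_sum_fun {ι : Type*} (s : Finset ι) {f : ι → E → F} (hf : ∀ i, ContDiff ℝ ∞ (f i))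
    (v : E) : dd v (fun x => ∑ i ∈ s, f i x) = fun x => ∑ i ∈ s, dd v (f i) x := by
  funext x
  simp only [dd]
  rw [fderiv_fun_sum (fun i _ => differentiable (hf i) x)]
  simp

theorem dd_sub_dir (f : E → F) (v w x : E) : dd (v - w) f x = dd v f x - dd w f x := by
  simp [dd]

theorem hasDerivAt_comp_line {f : E → F} (hf : ContDiff ℝ ∞ f) {γ : ℝ → E} {v : E} {t : ℝ}
    (hγ : HasDerivAt γ v t) : HasDerivAt (fun s => f (γ s)) (dd v f (γ t)) t :=
  (differentiable hf (γ t)).hasFDerivAt.comp_hasDerivAt t hγ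

theorem hasDerivAt_line (q w : E) : HasDerivAt (fun s : ℝ => q + s • w) w 0 := by
  simpa using ((hasDerivAt_id (0 : ℝ)).smul_const w).const_add q

theorem dd_zero_dir (f : E → F) (x : E) : dd 0 f x = 0 := by simp [dd]

/-- Integration over an interval in the last variable. -/
noncomputable def intLast (a b : ℝ) (f : E × ℝ → F) (x : E) : F := ∫ s in a..b, f (x, s)

theorem hasFDerivAt_intLast [ProperSpace E] [CompleteSpace F] (a b : ℝ) {f : E × ℝ → F}
    (hf : ContDiff ℝ ∞ f) (x : E) :
    HasFDerivAt (intLast a b f)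
      (intLast a b (fun q => (fderiv ℝ f q).comp (ContinuousLinearMap.inl ℝ E ℝ)) x) x := by
  have hc : Continuous fun q => (fderiv ℝ f q).comp (ContinuousLinearMap.inl ℝ E ℝ) :=
    (hf.continuous_fderiv (by simp)).clm_comp continuous_const
  have hfc := hf.continuous
  obtain ⟨C, hC⟩ := ((isCompact_closedBall x 1).prod
    (isCompact_uIcc (a := a) (b := b))).exists_bound_of_continuousOn hc.continuousOn
  refine intervalIntegral.hasFDerivAt_integral_of_dominated_of_fderiv_le
    (F := fun y s => f (y, s)) (bound := fun _ => C)
    (F' := fun y s => (fderiv ℝ f (y, s)).comp (ContinuousLinearMap.inl ℝ E ℝ))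
    (Metric.ball_mem_nhds x one_pos) ?_ ?_ ?_ ?_ ?_ ?_
  · exact .of_forall fun y => Continuous.aestronglyMeasurable (by fun_prop)
  · exact Continuous.intervalIntegrable (by fun_prop) _ _
  · exact (hc.comp (by fun_prop : Continuous fun s : ℝ => (x, s))).aestronglyMeasurable
  · refine .of_forall fun s hs y hy => hC (y, s) ⟨Metric.ball_subset_closedBall hy, ?_⟩
    exact Set.uIoc_subset_uIcc hs
  · exact intervalIntegrable_const
  · refine .of_forall fun s _ y _ => ?_
    have h1 : HasFDerivAt (fun y : E => (y, s)) (ContinuousLinearMap.inl ℝ E ℝ) y :=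
      hasFDerivAt_prodMk_left y s
    exact ((differentiable hf (y, s)).hasFDerivAt).comp y h1

theorem contDiff_intLast [ProperSpace E] [CompleteSpace F] (a b : ℝ) {f : E × ℝ → F}
    (hf : ContDiff ℝ ∞ f) : ContDiff ℝ ∞ (intLast a b f) := by
  rw [contDiff_infty]
  intro n
  induction n generalizing F with
  | zero =>
    rw [Nat.cast_zero, contDiff_zero]
    exact (Differentiable.continuous (𝕜 := ℝ)
      fun x => (hasFDerivAt_intLast a b hf x).differentiableAt)
  | succ n ih =>
    rw [Nat.cast_add, Nat.cast_one, contDiff_succ_iff_fderiv]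
    refine ⟨fun x => (hasFDerivAt_intLast a b hf x).differentiableAt, by simp, ?_⟩
    have h : fderiv ℝ (intLast a b f) =
        intLast a b (fun q => (fderiv ℝ f q).comp (ContinuousLinearMap.inl ℝ E ℝ)) :=
      funext fun x => (hasFDerivAt_intLast a b hf x).fderiv
    rw [h]
    exact ih ((hf.fderiv_right (m := ∞) (by simp)).clm_comp contDiff_const)

theorem dd_intLast [ProperSpace E] [CompleteSpace F] (a b : ℝ) {f : E × ℝ → F}
    (hf : ContDiff ℝ ∞ f) (v : E) : dd v (intLast a b f) = intLast a b (dd (v, 0) f) := by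
  have hc : Continuous fun q => (fderiv ℝ f q).comp (ContinuousLinearMap.inl ℝ E ℝ) :=
    (hf.continuous_fderiv (by simp)).clm_comp continuous_const
  funext x
  rw [dd, (hasFDerivAt_intLast a b hf x).fderiv]
  exact ContinuousLinearMap.intervalIntegral_apply
    ((hc.comp (by fun_prop : Continuous fun s : ℝ => (x, s))).intervalIntegrable _ _) v

theorem intLast_dd_last [CompleteSpace F] (a b : ℝ) {f : E × ℝ → F}
    (hf : ContDiff ℝ ∞ f) (x : E) : intLast a b (dd (0, 1) f) x = f (x, b) - f (x, a) := by
  refine intervalIntegral.integral_eq_sub_of_hasDerivAt (f := fun s => f (x, s))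
    (fun s _ => hasDerivAt_comp_line hf ?_) ?_
  · exact (hasDerivAt_const s x).prodMk (hasDerivAt_id s)
  · exact ((contDiff_dd hf _).continuous.comp (by fun_prop)).intervalIntegrable _ _

end Calculus

section Sphere

open Real

/-- The unit vector with polar angle `θ = p.1` and azimuth `φ = p.2`. -/
noncomputable def om (p : ℝ × ℝ) : V3 := ![sin p.1 * cos p.2, sin p.1 * sin p.2, cos p.1]

/-- The unit tangent vector in the polar direction. -/
noncomputable def omθ (p : ℝ × ℝ) : V3 := ![cos p.1 * cos p.2, cos p.1 * sin p.2, -sin p.1]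

/-- The unit tangent vector in the azimuthal direction. -/
noncomputable def omφ (p : ℝ × ℝ) : V3 := ![-sin p.2, cos p.2, 0]

theorem contDiff_om : ContDiff ℝ ∞ om := by
  refine contDiff_pi.2 fun i => ?_
  fin_cases i <;> simp [om] <;> fun_prop

theorem contDiff_omθ : ContDiff ℝ ∞ omθ := by
  refine contDiff_pi.2 fun i => ?_
  fin_cases i <;> simp [omθ] <;> fun_prop

theorem contDiff_omφ : ContDiff ℝ ∞ omφ := by
  refine contDiff_pi.2 fun i => ?_
  fin_cases i <;> simp [omφ] <;> fun_prop

theorem dd_fst_eq {F : Type} [NormedAddCommGroup F] [NormedSpace ℝ F] {f : ℝ × ℝ → F}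
    (hf : ContDiff ℝ ∞ f) {p : ℝ × ℝ} {d : F}
    (h : HasDerivAt (fun s => f (s, p.2)) d p.1) : dd (1, 0) f p = d :=
  (hasDerivAt_comp_line hf
    ((hasDerivAt_id p.1).prodMk (hasDerivAt_const p.1 p.2))).unique h

theorem dd_snd_eq {F : Type} [NormedAddCommGroup F] [NormedSpace ℝ F] {f : ℝ × ℝ → F}
    (hf : ContDiff ℝ ∞ f) {p : ℝ × ℝ} {d : F}
    (h : HasDerivAt (fun s => f (p.1, s)) d p.2) : dd (0, 1) f p = d :=
  (hasDerivAt_comp_line hf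
    ((hasDerivAt_const p.2 p.1).prodMk (hasDerivAt_id p.2))).unique h

theorem dd_om_fst (p : ℝ × ℝ) : dd (1, 0) om p = omθ p := by
  refine dd_fst_eq contDiff_om (hasDerivAt_pi.2 fun i => ?_)
  have hs := hasDerivAt_sin p.1
  have hc := hasDerivAt_cos p.1
  fin_cases i
  · simpa [om, omθ] using hs.mul_const (cos p.2)
  · simpa [om, omθ] using hs.mul_const (sin p.2)
  · simpa [om, omθ] using hc

theorem dd_om_snd (p : ℝ × ℝ) : dd (0, 1) om p = sin p.1 • omφ p := by
  refine dd_snd_eq contDiff_om (hasDerivAt_pi.2 fun i => ?_)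
  have hs := hasDerivAt_sin p.2
  have hc := hasDerivAt_cos p.2
  fin_cases i
  · simpa [om, omφ] using hc.const_mul (sin p.1)
  · simpa [om, omφ] using hs.const_mul (sin p.1)
  · simpa [om, omφ] using hasDerivAt_const p.2 (cos p.1)

theorem dd_sin_mul_omθ (j : Fin 3) (p : ℝ × ℝ) :
    dd (1, 0) (fun p => sin p.1 * omθ p j) p = cos p.1 * omθ p j - sin p.1 * om p j := by
  have h := contDiff_pi.1 contDiff_omθ j
  refine dd_fst_eq (by fun_prop) ?_
  have hs := hasDerivAt_sin p.1
  have hc := hasDerivAt_cos p.1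
  fin_cases j
  · simpa [om, omθ, sub_eq_add_neg] using hs.fun_mul (hc.mul_const (cos p.2))
  · simpa [om, omθ, sub_eq_add_neg] using hs.fun_mul (hc.mul_const (sin p.2))
  · simpa [om, omθ, sub_eq_add_neg] using hs.fun_mul hs.fun_neg

theorem dd_omφ_snd (j : Fin 3) (p : ℝ × ℝ) :
    dd (0, 1) (fun p => omφ p j) p = - (![cos p.2, sin p.2, 0] : V3) j := by
  refine dd_snd_eq (contDiff_pi.1 contDiff_omφ j) ?_
  have hs := hasDerivAt_sin p.2
  have hc := hasDerivAt_cos p.2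
  fin_cases j
  · simpa [omφ] using hs.fun_neg
  · simpa [omφ] using hc
  · simpa [omφ] using hasDerivAt_const p.2 (0 : ℝ)

theorem divergence_weights (j : Fin 3) (p : ℝ × ℝ) :
    cos p.1 * omθ p j - sin p.1 * om p j + - (![cos p.2, sin p.2, 0] : V3) j
      = - 2 * (sin p.1 * om p j) := by
  have h := sin_sq_add_cos_sq p.1
  fin_cases j <;> simp [om, omθ]
  · linear_combination cos p.2 * h
  · linear_combination sin p.2 * h
  · ring

theorem tangential_weights (i j : Fin 3) (p : ℝ × ℝ) :
    omθ p j * omθ p i + omφ p j * omφ p i = (if i = j then 1 else 0) - om p j * om p i := by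
  have h := sin_sq_add_cos_sq p.1
  have h' := sin_sq_add_cos_sq p.2
  fin_cases i <;> fin_cases j <;> simp [om, omθ, omφ]
  · linear_combination cos p.2 ^ 2 * h + h'
  · linear_combination cos p.2 * sin p.2 * h
  · ring
  · linear_combination cos p.2 * sin p.2 * h
  · linear_combination sin p.2 ^ 2 * h + h'
  · ring
  · ring
  · ring
  · linear_combination h

/-- The basis vectors of `ℝ³`. -/
noncomputable abbrev e (i : Fin 3) : V3 := Pi.single i 1

theorem eq_sum_e (w : V3) : w = ∑ i, w i • e i := by
  ext j
  simp [Finset.sum_apply, Pi.single_apply]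

theorem fderiv_space (u : ℝ × V3 → ℝ) (y : ℝ × V3) (w : V3) :
    fderiv ℝ u y (0, w) = ∑ i, w i * dd (0, e i) u y := by
  have : ((0 : ℝ), w) = ∑ i, w i • ((0 : ℝ), e i) := by
    refine Prod.ext ?_ ?_
    · simp [Prod.fst_sum]
    · simpa [Prod.snd_sum] using eq_sum_e w
  rw [this, map_sum]
  simp only [map_smul, smul_eq_mul, dd]

/-- The point of the sphere of radius `r` about `x` in the direction of the given angles, for
`q = (((s, r, x), θ), φ)`, kept in the time slice `s`. -/
noncomputable def spherePoint (q : ((ℝ × ℝ × V3) × ℝ) × ℝ) : ℝ × V3 :=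
  (q.1.1.1, q.1.1.2.2 + q.1.1.2.1 • om (q.1.2, q.2))

theorem contDiff_spherePoint : ContDiff ℝ ∞ spherePoint := by
  have := contDiff_om
  unfold spherePoint
  fun_prop

theorem dd_spherePoint (w q : ((ℝ × ℝ × V3) × ℝ) × ℝ) :
    dd w spherePoint q = (w.1.1.1, w.1.1.2.2 + (w.1.1.2.1 • om (q.1.2, q.2)
      + q.1.1.2.1 • dd (w.1.2, w.2) om (q.1.2, q.2))) := by
  have h1 := hasDerivAt_comp_line contDiff_spherePoint (hasDerivAt_line q w)
  have hom := hasDerivAt_comp_line contDiff_om (hasDerivAt_line (q.1.2, q.2) (w.1.2, w.2))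
  have h2 := (hasDerivAt_line q.1.1.1 w.1.1.1).prodMk ((hasDerivAt_line q.1.1.2.2 w.1.1.2.2).add
    ((hasDerivAt_line q.1.1.2.1 w.1.1.2.1).smul hom))
  have h3 := h1.unique h2
  simp only [zero_smul, add_zero] at h3
  rw [h3, add_comm (w.1.1.2.1 • _)]

/-- The integrand of a weighted spherical integral. -/
noncomputable def weighted (c : ℝ × ℝ → ℝ) (u : ℝ × V3 → ℝ)
    (q : ((ℝ × ℝ × V3) × ℝ) × ℝ) : ℝ :=
  c (q.1.2, q.2) * u (spherePoint q)

variable {c c' : ℝ × ℝ → ℝ} {u : ℝ × V3 → ℝ}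

theorem contDiff_weighted (hc : ContDiff ℝ ∞ c) (hu : ContDiff ℝ ∞ u) :
    ContDiff ℝ ∞ (weighted c u) := by
  have := contDiff_spherePoint
  unfold weighted
  fun_prop

theorem dd_weighted (hc : ContDiff ℝ ∞ c) (hu : ContDiff ℝ ∞ u)
    (w q : ((ℝ × ℝ × V3) × ℝ) × ℝ) :
    dd w (weighted c u) q = dd (w.1.2, w.2) c (q.1.2, q.2) * u (spherePoint q)
      + c (q.1.2, q.2) * fderiv ℝ u (spherePoint q) (dd w spherePoint q) := by
  have h1 := hasDerivAt_comp_line (contDiff_weighted hc hu) (hasDerivAt_line q w)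
  have h2 := (hasDerivAt_comp_line hc (hasDerivAt_line (q.1.2, q.2) (w.1.2, w.2))).mul
    (hasDerivAt_comp_line hu (hasDerivAt_comp_line contDiff_spherePoint (hasDerivAt_line q w)))
  have h3 := h1.unique h2
  simp only [zero_smul, add_zero] at h3
  exact h3

/-- Integration over both angles. -/
noncomputable def angInt (f : ((ℝ × ℝ × V3) × ℝ) × ℝ → ℝ) : ℝ × ℝ × V3 → ℝ :=
  intLast 0 π (intLast 0 (2 * π) f)

theorem angInt_add {f g : ((ℝ × ℝ × V3) × ℝ) × ℝ → ℝ} (hf : ContDiff ℝ ∞ f)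
    (hg : ContDiff ℝ ∞ g) (p : ℝ × ℝ × V3) :
    angInt (fun q => f q + g q) p = angInt f p + angInt g p := by
  have add {G : Type} [NormedAddCommGroup G] [NormedSpace ℝ G] (a b : ℝ) {f g : G × ℝ → ℝ}
      (hf : ContDiff ℝ ∞ f) (hg : ContDiff ℝ ∞ g) :
      intLast a b (fun q => f q + g q) = fun x => intLast a b f x + intLast a b g x := by
    have hf := hf.continuous
    have hg := hg.continuous
    exact funext fun x => intervalIntegral.integral_add
      (Continuous.intervalIntegrable (by fun_prop) _ _)
      (Continuous.intervalIntegrable (by fun_prop) _ _)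
  rw [angInt, add _ _ hf hg, add _ _ (contDiff_intLast _ _ hf) (contDiff_intLast _ _ hg)]
  rfl

theorem angInt_const_mul (a : ℝ) (f : ((ℝ × ℝ × V3) × ℝ) × ℝ → ℝ) (p : ℝ × ℝ × V3) :
    angInt (fun q => a * f q) p = a * angInt f p := by
  simp only [angInt, intLast, intervalIntegral.integral_const_mul]

theorem angInt_radius_mul (f : ((ℝ × ℝ × V3) × ℝ) × ℝ → ℝ) (p : ℝ × ℝ × V3) :
    angInt (fun q => q.1.1.2.1 * f q) p = p.2.1 * angInt f p := by
  simp only [angInt, intLast, intervalIntegral.integral_const_mul]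

theorem angInt_sum {f : Fin 3 → ((ℝ × ℝ × V3) × ℝ) × ℝ → ℝ} (hf : ∀ i, ContDiff ℝ ∞ (f i))
    (p : ℝ × ℝ × V3) : angInt (fun q => ∑ i, f i q) p = ∑ i, angInt (f i) p := by
  have h0 := hf 0
  have h1 := hf 1
  have h2 := hf 2
  simp only [Fin.sum_univ_three]
  rw [angInt_add (by fun_prop) (by fun_prop), angInt_add (by fun_prop) (by fun_prop)]

theorem dd_angInt {f : ((ℝ × ℝ × V3) × ℝ) × ℝ → ℝ} (hf : ContDiff ℝ ∞ f) (v : ℝ × ℝ × V3) :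
    dd v (angInt f) = angInt (dd ((v, 0), 0) f) := by
  rw [angInt, dd_intLast _ _ (contDiff_intLast _ _ hf), dd_intLast _ _ hf]
  rfl

/-- The spherical integral of `u` with weight `c`, at `(s, r, x)`. -/
noncomputable def avg (c : ℝ × ℝ → ℝ) (u : ℝ × V3 → ℝ) : ℝ × ℝ × V3 → ℝ := angInt (weighted c u)

theorem contDiff_avg (hc : ContDiff ℝ ∞ c) (hu : ContDiff ℝ ∞ u) : ContDiff ℝ ∞ (avg c u) :=
  contDiff_intLast _ _ (contDiff_intLast _ _ (contDiff_weighted hc hu))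

theorem avg_add_weight (hc : ContDiff ℝ ∞ c) (hc' : ContDiff ℝ ∞ c') (hu : ContDiff ℝ ∞ u)
    (p : ℝ × ℝ × V3) : avg (fun a => c a + c' a) u p = avg c u p + avg c' u p := by
  rw [avg, avg, avg, ← angInt_add (contDiff_weighted hc hu) (contDiff_weighted hc' hu)]
  congr 1
  funext q
  simp only [weighted]
  ring

theorem avg_const_mul_weight (a : ℝ) (p : ℝ × ℝ × V3) :
    avg (fun b => a * c b) u p = a * avg c u p := by
  rw [avg, avg, ← angInt_const_mul]
  congr 1
  funext q
  simp only [weighted]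
  ring

theorem dd_avg_of_radial_eq_zero (hc : ContDiff ℝ ∞ c) (hu : ContDiff ℝ ∞ u) (a : ℝ) (w : V3) :
    dd (a, 0, w) (avg c u) = avg c (dd (a, w) u) := by
  rw [avg, dd_angInt (contDiff_weighted hc hu), avg]
  congr 1
  funext q
  rw [dd_weighted hc hu, dd_spherePoint]
  simp [weighted, Prod.mk_zero_zero, dd]

theorem dd_radial_avg (hc : ContDiff ℝ ∞ c) (hu : ContDiff ℝ ∞ u) (p : ℝ × ℝ × V3) :
    dd (0, 1, 0) (avg c u) p = ∑ i, avg (fun a => c a * om a i) (dd (0, e i) u) p := by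
  have hom := contDiff_pi.1 contDiff_om
  simp only [avg]
  rw [dd_angInt (contDiff_weighted hc hu),
    ← angInt_sum fun i => contDiff_weighted (hc.mul (hom i)) (contDiff_dd hu _)]
  congr 1
  funext q
  rw [dd_weighted hc hu, dd_spherePoint]
  simp only [Prod.mk_zero_zero, dd_zero_dir, fderiv_space, weighted, Finset.mul_sum, mul_assoc]
  simp

/-- Integration by parts in an angular direction `v`, for a weight `c` that does not contribute
boundary terms. -/
theorem angular_parts (hc : ContDiff ℝ ∞ c) (hu : ContDiff ℝ ∞ u) (p : ℝ × ℝ × V3) (a b : ℝ) :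
    angInt (dd ((0, a), b) (weighted c u)) p = avg (dd (a, b) c) u p
      + p.2.1 * ∑ i, avg (fun y => c y * dd (a, b) om y i) (dd (0, e i) u) p := by
  have hom := contDiff_pi.1 (contDiff_dd contDiff_om (a, b))
  have hw (i : Fin 3) : ContDiff ℝ ∞
      (weighted (fun y => c y * dd (a, b) om y i) (dd (0, e i) u)) :=
    contDiff_weighted (hc.mul (hom i)) (contDiff_dd hu _)
  simp only [avg]
  rw [← angInt_sum hw, ← angInt_radius_mul, ← angInt_add (contDiff_weighted (contDiff_dd hc _) hu)
    (by fun_prop)]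
  refine congrFun (congrArg angInt (funext fun q => ?_)) p
  rw [dd_weighted hc hu, dd_spherePoint]
  simp only [Prod.fst_zero, Prod.snd_zero, zero_smul, zero_add, fderiv_space, weighted,
    Finset.mul_sum, Pi.smul_apply, smul_eq_mul]
  congr 1
  refine Finset.sum_congr rfl fun i _ => ?_
  ring

/-- The area density of the unit sphere in the angles. -/
noncomputable def area (y : ℝ × ℝ) : ℝ := sin y.1

theorem contDiff_area : ContDiff ℝ ∞ area := by
  unfold area
  fun_prop

theorem parts_polar (hu : ContDiff ℝ ∞ u) (hc : ContDiff ℝ ∞ c) (p : ℝ × ℝ × V3) :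
    avg (dd (1, 0) (fun y => sin y.1 * c y)) u p
      + p.2.1 * ∑ i, avg (fun y => sin y.1 * c y * omθ y i) (dd (0, e i) u) p = 0 := by
  have h := angular_parts (c := fun y => sin y.1 * c y) (by fun_prop) hu p 1 0
  simp only [dd_om_fst] at h
  have hw : ContDiff ℝ ∞ (weighted (fun y => sin y.1 * c y) u) :=
    contDiff_weighted (by fun_prop) hu
  rw [← h, angInt, ← dd_intLast _ _ hw, intLast_dd_last _ _ (contDiff_intLast _ _ hw)]
  simp [intLast, weighted]

theorem parts_azimuthal (hu : ContDiff ℝ ∞ u) (hc : ContDiff ℝ ∞ c)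
    (hper : ∀ θ, c (θ, 2 * π) = c (θ, 0)) (p : ℝ × ℝ × V3) :
    avg (dd (0, 1) c) u p
      + p.2.1 * ∑ i, avg (fun y => c y * (sin y.1 * omφ y i)) (dd (0, e i) u) p = 0 := by
  have h := angular_parts hc hu p 0 1
  simp only [dd_om_snd, Pi.smul_apply, smul_eq_mul] at h
  have hw := contDiff_weighted hc hu
  have h0 : intLast 0 (2 * π) (dd (((0 : ℝ × ℝ × V3), (0 : ℝ)), (1 : ℝ)) (weighted c u)) = 0 := by
    funext x
    rw [Prod.mk_zero_zero, intLast_dd_last _ _ hw]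
    simp [weighted, spherePoint, hper, om]
  rw [← h, angInt, h0]
  simp [intLast]


theorem avg_tangential (hu : ContDiff ℝ ∞ u) (j : Fin 3) (p : ℝ × ℝ × V3) :
    p.2.1 * avg area (dd (0, e j) u) p =
      2 * avg (fun y => area y * om y j) u p
        + p.2.1 * ∑ i, avg (fun y => area y * om y j * om y i) (dd (0, e i) u) p := by
  have hθ := contDiff_pi.1 contDiff_omθ
  have hφ := contDiff_pi.1 contDiff_omφ
  have ho := contDiff_pi.1 contDiff_om
  have ha := contDiff_area
  have h1 := parts_polar hu (hθ j) p
  have h2 := parts_azimuthal hu (hφ j) (fun θ => by simp [omφ]) p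
  have hfirst : avg (dd (1, 0) (fun y => sin y.1 * omθ y j)) u p
      + avg (dd (0, 1) (fun y => omφ y j)) u p = -2 * avg (fun y => area y * om y j) u p := by
    rw [← avg_add_weight (contDiff_dd (by fun_prop) _) (contDiff_dd (hφ j) _) hu,
      ← avg_const_mul_weight]
    refine congrFun (congrArg (avg · u) (funext fun y => ?_)) p
    rw [dd_sin_mul_omθ, dd_omφ_snd, divergence_weights]
    rfl
  have hsecond (i : Fin 3) : avg (fun y => sin y.1 * omθ y j * omθ y i) (dd (0, e i) u) p
      + avg (fun y => omφ y j * (sin y.1 * omφ y i)) (dd (0, e i) u) p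
      = (if i = j then 1 else 0) * avg area (dd (0, e i) u) p
        + (-1) * avg (fun y => area y * om y j * om y i) (dd (0, e i) u) p := by
    have hi := contDiff_dd hu (0, e i)
    rw [← avg_add_weight (by fun_prop) (by fun_prop) hi, ← avg_const_mul_weight,
      ← avg_const_mul_weight, ← avg_add_weight (by fun_prop) (by fun_prop) hi]
    refine congrFun (congrArg (avg · _) (funext fun y => ?_)) p
    rw [area]
    linear_combination sin y.1 * tangential_weights i j y
  have hsum := Finset.sum_congr (rfl : Finset.univ = Finset.univ) fun i _ => hsecond i
  simp only [Finset.sum_add_distrib, ite_mul, one_mul, zero_mul, Finset.sum_ite_eq',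
    Finset.mem_univ, if_true, ← Finset.mul_sum] at hsum
  linear_combination h1 + h2 - hfirst - p.2.1 * hsum

/-- The Kirchhoff kernel: `r` times the mean of `u (s, ·)` over the sphere of radius `r` about `x`,
as a function of `(s, r, x)`. -/
noncomputable def kir (u : ℝ × V3 → ℝ) (p : ℝ × ℝ × V3) : ℝ :=
  (4 * π)⁻¹ * (p.2.1 * avg area u p)

/-- The radial derivative of the Kirchhoff kernel. -/
noncomputable def kirDot (u : ℝ × V3 → ℝ) : ℝ × ℝ × V3 → ℝ := dd (0, 1, 0) (kir u)

theorem contDiff_kir (hu : ContDiff ℝ ∞ u) : ContDiff ℝ ∞ (kir u) := by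
  have := contDiff_avg contDiff_area hu
  unfold kir
  fun_prop

theorem contDiff_kirDot (hu : ContDiff ℝ ∞ u) : ContDiff ℝ ∞ (kirDot u) :=
  contDiff_dd (contDiff_kir hu) _

theorem dd_kir_aux {g : ℝ × ℝ × V3 → ℝ} (hg : ContDiff ℝ ∞ g) (v p : ℝ × ℝ × V3) :
    dd v (fun p => (4 * π)⁻¹ * (p.2.1 * g p)) p
      = (4 * π)⁻¹ * (v.2.1 * g p + p.2.1 * dd v g p) := by
  have h1 := hasDerivAt_comp_line
    (f := fun p : ℝ × ℝ × V3 => (4 * π)⁻¹ * (p.2.1 * g p)) (by fun_prop) (hasDerivAt_line p v)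
  have h2 := ((hasDerivAt_line p.2.1 v.2.1).mul
    (hasDerivAt_comp_line hg (hasDerivAt_line p v))).const_mul (4 * π)⁻¹
  have h3 := h1.unique h2
  simp only [zero_smul, add_zero] at h3
  exact h3

theorem dd_kir (hu : ContDiff ℝ ∞ u) (a : ℝ) (w : V3) :
    dd (a, 0, w) (kir u) = kir (dd (a, w) u) := by
  funext p
  unfold kir
  rw [dd_kir_aux (contDiff_avg contDiff_area hu),
    dd_avg_of_radial_eq_zero contDiff_area hu]
  simp

theorem dd_kirDot (hu : ContDiff ℝ ∞ u) (a : ℝ) (w : V3) :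
    dd (a, 0, w) (kirDot u) = kirDot (dd (a, w) u) := by
  rw [kirDot, dd_comm (contDiff_kir hu), dd_kir hu, kirDot]

theorem kirDot_apply (hu : ContDiff ℝ ∞ u) (p : ℝ × ℝ × V3) :
    kirDot u p = (4 * π)⁻¹ * (avg area u p
      + p.2.1 * ∑ i, avg (fun y => area y * om y i) (dd (0, e i) u) p) := by
  unfold kirDot kir
  rw [dd_kir_aux (contDiff_avg contDiff_area hu), dd_radial_avg contDiff_area hu]
  simp

/-- The Kirchhoff kernel solves the wave equation. -/
theorem dd_radial_kirDot (hu : ContDiff ℝ ∞ u) (p : ℝ × ℝ × V3) :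
    dd (0, 1, 0) (kirDot u) p = ∑ j, kir (dd (0, e j) (dd (0, e j) u)) p := by
  have ho := contDiff_pi.1 contDiff_om
  have hw (i : Fin 3) : ContDiff ℝ ∞ fun y => area y * om y i := contDiff_area.mul (ho i)
  have hA := contDiff_avg contDiff_area hu
  have hu' (i : Fin 3) := contDiff_dd hu (0, e i)
  have hS : ContDiff ℝ ∞ fun p => ∑ i, avg (fun y => area y * om y i) (dd (0, e i) u) p :=
    ContDiff.sum fun i _ => contDiff_avg (hw i) (hu' i)
  have hk : kirDot u = fun p => (4 * π)⁻¹ * avg area u p + (4 * π)⁻¹ *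
      (p.2.1 * ∑ i, avg (fun y => area y * om y i) (dd (0, e i) u) p) := by
    funext p
    rw [kirDot_apply hu]
    ring
  rw [hk, dd_add_fun (by fun_prop) (by fun_prop)]
  have hc : dd (0, 1, 0) (fun p => (4 * π)⁻¹ * avg area u p) p
      = (4 * π)⁻¹ * dd (0, 1, 0) (avg area u) p := by
    simp only [dd]
    rw [fderiv_const_mul (differentiable hA p)]
    rfl
  simp only [hc, dd_kir_aux hS, dd_radial_avg contDiff_area hu,
    dd_sum_fun Finset.univ fun i => contDiff_avg (hw i) (hu' i),
    dd_radial_avg (hw _) (hu' _), kir, ← Finset.mul_sum]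
  have h := Finset.sum_congr (rfl : (Finset.univ : Finset (Fin 3)) = Finset.univ)
    fun j _ => avg_tangential (hu' j) j p
  simp only [Finset.sum_add_distrib, ← Finset.mul_sum] at h
  rw [h]
  ring

theorem kir_radius_zero (s : ℝ) (x : V3) : kir u (s, 0, x) = 0 := by simp [kir]

theorem kirDot_radius_zero (hu : ContDiff ℝ ∞ u) (s : ℝ) (x : V3) :
    kirDot u (s, 0, x) = u (s, x) := by
  rw [kirDot_apply hu]
  simp [avg, angInt, intLast, weighted, spherePoint, area]
  field_simp
  norm_num

theorem kir_congr {u' : ℝ × V3 → ℝ} {s : ℝ} (h : ∀ x, u (s, x) = u' (s, x)) (r : ℝ) (x : V3) :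
    kir u (s, r, x) = kir u' (s, r, x) := by
  simp [kir, avg, angInt, intLast, weighted, spherePoint, h]

theorem kirDot_congr (hu : ContDiff ℝ ∞ u) {u' : ℝ × V3 → ℝ} (hu' : ContDiff ℝ ∞ u') {s : ℝ}
    (h : ∀ x, u (s, x) = u' (s, x)) (r : ℝ) (x : V3) :
    kirDot u (s, r, x) = kirDot u' (s, r, x) := by
  have hl : HasDerivAt (fun r : ℝ => (s, r, x)) (0, 1, 0) r :=
    (hasDerivAt_const r s).prodMk ((hasDerivAt_id r).prodMk (hasDerivAt_const r x))
  refine (hasDerivAt_comp_line (contDiff_kir hu) hl).unique ?_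
  simp only [kir_congr h]
  exact hasDerivAt_comp_line (contDiff_kir hu') hl

theorem kir_sub {u' : ℝ × V3 → ℝ} (hu : ContDiff ℝ ∞ u) (hu' : ContDiff ℝ ∞ u') :
    kir (fun q => u q - u' q) = fun p => kir u p - kir u' p := by
  funext p
  have h : avg area (fun q => u q - u' q) p = avg area u p + (-1) * avg area u' p := by
    rw [avg, avg, avg, ← angInt_const_mul, ← angInt_add (contDiff_weighted contDiff_area hu)
      (contDiff_const.mul (contDiff_weighted contDiff_area hu'))]
    refine congrFun (congrArg angInt (funext fun q => ?_)) p
    simp only [weighted]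
    ring
  rw [kir, h, kir, kir]
  ring

theorem kirDot_sub {u' : ℝ × V3 → ℝ} (hu : ContDiff ℝ ∞ u) (hu' : ContDiff ℝ ∞ u') :
    kirDot (fun q => u q - u' q) = fun p => kirDot u p - kirDot u' p := by
  rw [kirDot, kir_sub hu hu', dd_sub_fun (contDiff_kir hu) (contDiff_kir hu')]
  rfl

theorem kir_zero : kir (fun _ => 0) = fun _ => 0 := by
  funext p
  simp [kir, avg, angInt, intLast, weighted]

theorem kirDot_zero : kirDot (fun _ => 0) = fun _ => 0 := by
  funext p
  simp [kirDot, kir_zero, dd]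

theorem kir_neg {u : ℝ × V3 → ℝ} (hu : ContDiff ℝ ∞ u) :
    kir (fun q => - u q) = fun p => - kir u p := by
  simpa [kir_zero] using kir_sub (contDiff_const (c := 0)) hu

theorem kir_sum {f : Fin 3 → ℝ × V3 → ℝ} (hf : ∀ i, ContDiff ℝ ∞ (f i)) (p : ℝ × ℝ × V3) :
    kir (fun q => ∑ i, f i q) p = ∑ i, kir (f i) p := by
  have h : avg area (fun q => ∑ i, f i q) p = ∑ i, avg area (f i) p := by
    simp only [avg]
    rw [← angInt_sum fun i => contDiff_weighted contDiff_area (hf i)]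
    refine congrFun (congrArg angInt (funext fun q => ?_)) p
    simp only [weighted, Finset.mul_sum]
  simp only [kir, h, Finset.mul_sum]

theorem kirDot_sum {f : Fin 3 → ℝ × V3 → ℝ} (hf : ∀ i, ContDiff ℝ ∞ (f i)) (p : ℝ × ℝ × V3) :
    kirDot (fun q => ∑ i, f i q) p = ∑ i, kirDot (f i) p := by
  have h : kir (fun q => ∑ i, f i q) = fun p => ∑ i, kir (f i) p := funext (kir_sum hf)
  rw [kirDot, h, dd_sum_fun _ fun i => contDiff_kir (hf i)]
  rfl

end Sphere
section VectorCalculus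

/-- The components of the spatial curl of a field given by its components. -/
noncomputable def crl (v : Fin 3 → ℝ × V3 → ℝ) (i : Fin 3) (q : ℝ × V3) : ℝ :=
  dd (0, e (i + 1)) (v (i + 2)) q - dd (0, e (i + 2)) (v (i + 1)) q

/-- The spatial divergence of a field given by its components. -/
noncomputable def dvg (v : Fin 3 → ℝ × V3 → ℝ) (q : ℝ × V3) : ℝ :=
  ∑ i, dd (0, e i) (v i) q

variable {v w : Fin 3 → ℝ × V3 → ℝ}

theorem contDiff_crl (hv : ∀ i, ContDiff ℝ ∞ (v i)) (i : Fin 3) : ContDiff ℝ ∞ (crl v i) :=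
  (contDiff_dd (hv _) _).sub (contDiff_dd (hv _) _)

theorem dd_crl (hv : ∀ i, ContDiff ℝ ∞ (v i)) (a : ℝ × V3) (i : Fin 3) :
    dd a (crl v i) = crl (fun j => dd a (v j)) i := by
  unfold crl
  rw [dd_sub_fun (contDiff_dd (hv _) _) (contDiff_dd (hv _) _), dd_comm (hv _), dd_comm (hv _) a]

theorem crl_neg (v : Fin 3 → ℝ × V3 → ℝ) :
    crl (fun i q => - v i q) = fun i q => - crl v i q := by
  funext i q
  simp only [crl, dd_neg_fun]
  ring

theorem dvg_neg (v : Fin 3 → ℝ × V3 → ℝ) (q : ℝ × V3) :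
    dvg (fun i q => - v i q) q = - dvg v q := by
  simp [dvg, dd_neg_fun]

theorem dvg_crl (hv : ∀ i, ContDiff ℝ ∞ (v i)) (q : ℝ × V3) : dvg (crl v) q = 0 := by
  simp only [dvg, dd_crl hv, crl, Fin.sum_univ_three]
  rw [dd_comm (hv _) (0, e (0 + 1)), dd_comm (hv _) (0, e (0 + 2)), dd_comm (hv _) (0, e (1 + 1))]
  simp only [zero_add, Fin.isValue, Fin.reduceAdd]
  ring

theorem crl_crl (hv : ∀ i, ContDiff ℝ ∞ (v i)) (hdiv : ∀ q, dvg v q = 0) (i : Fin 3)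
    (q : ℝ × V3) : crl (crl v) i q = - ∑ j, dd (0, e j) (dd (0, e j) (v i)) q := by
  have h : dd (0, e i) (dvg v) q = 0 := by
    rw [show dvg v = fun _ => 0 from funext hdiv]
    simp [dd]
  unfold dvg at h
  rw [dd_sum_fun _ fun j => contDiff_dd (hv j) _] at h
  simp only [Fin.sum_univ_three] at h
  rw [crl, dd_crl hv, dd_crl hv]
  simp only [crl, Fin.sum_univ_three]
  fin_cases i <;> simp only [Fin.zero_eta, Fin.mk_one, Fin.reduceFinMk, zero_add, Fin.isValue,
    Fin.reduceAdd] at h ⊢ <;> linear_combination h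

theorem pd_eq_dd {u : ℝ × V3 → ℝ} (hu : ContDiff ℝ ∞ u) (i : Fin 3) (q : ℝ × V3) :
    pd i u q = dd (0, e i) u q := by
  have h : HasFDerivAt (fun x : V3 => (q.1, x)) (ContinuousLinearMap.inr ℝ ℝ V3) q.2 :=
    hasFDerivAt_prodMk_right q.1 q.2
  have h' := ((differentiable hu q).hasFDerivAt).comp q.2 h
  exact congrFun (congrArg DFunLike.coe h'.fderiv) _

theorem crl_congr (hv : ∀ i, ContDiff ℝ ∞ (v i)) (hw : ∀ i, ContDiff ℝ ∞ (w i)) {s : ℝ}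
    (h : ∀ i x, v i (s, x) = w i (s, x)) (i : Fin 3) (x : V3) :
    crl v i (s, x) = crl w i (s, x) := by
  simp only [crl, ← pd_eq_dd (hv _), ← pd_eq_dd (hw _), pd, h]

variable {V : ℝ × V3 → V3}

theorem div3_eq_dvg (hV : ContDiff ℝ ∞ V) (q : ℝ × V3) :
    div3 V q = dvg (fun i q => V q i) q :=
  Finset.sum_congr rfl fun i _ => pd_eq_dd (contDiff_pi.1 hV i) i q

theorem curl3_eq_crl (hV : ContDiff ℝ ∞ V) (q : ℝ × V3) :
    curl3 V q = fun i => crl (fun i q => V q i) i q := by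
  funext i
  simp only [crl, ← pd_eq_dd (contDiff_pi.1 hV _)]
  fin_cases i <;> rfl

theorem tdVec_eq_dd (hV : ContDiff ℝ ∞ V) (q : ℝ × V3) :
    tdVec V q = fun i => dd (1, 0) (fun q => V q i) q := by
  have hl : HasDerivAt (fun s : ℝ => (s, q.2)) (1, 0) q.1 :=
    (hasDerivAt_id q.1).prodMk (hasDerivAt_const q.1 q.2)
  exact (hasDerivAt_pi.2 fun i => hasDerivAt_comp_line (contDiff_pi.1 hV i) hl).deriv

end VectorCalculus

section Evolution

variable {E B : Fin 3 → ℝ × V3 → ℝ}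

/-- The first field of the solution of Maxwell's equations whose Cauchy data are the restrictions
of `E` and `B` to time zero. -/
noncomputable def evol (E B : Fin 3 → ℝ × V3 → ℝ) (i : Fin 3) (q : ℝ × V3) : ℝ :=
  kirDot (E i) (0, q) + kir (crl B i) (0, q)

theorem contDiff_slice {g : ℝ × ℝ × V3 → ℝ} (hg : ContDiff ℝ ∞ g) :
    ContDiff ℝ ∞ fun q : ℝ × V3 => g (0, q) := by
  fun_prop

theorem dd_slice {g : ℝ × ℝ × V3 → ℝ} (hg : ContDiff ℝ ∞ g) (a : ℝ × V3) :
    dd a (fun q : ℝ × V3 => g (0, q)) = fun q => dd (0, a) g (0, q) := by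
  funext q
  have h : HasFDerivAt (fun q : ℝ × V3 => ((0 : ℝ), q)) (ContinuousLinearMap.inr ℝ ℝ (ℝ × V3)) q :=
    hasFDerivAt_prodMk_right 0 q
  have h' := ((differentiable hg (0, q)).hasFDerivAt).comp q h
  exact congrFun (congrArg DFunLike.coe h'.fderiv) _

theorem contDiff_evol (hE : ∀ i, ContDiff ℝ ∞ (E i)) (hB : ∀ i, ContDiff ℝ ∞ (B i)) (i : Fin 3) :
    ContDiff ℝ ∞ (evol E B i) :=
  (contDiff_slice (contDiff_kirDot (hE i))).add (contDiff_slice (contDiff_kir (contDiff_crl hB i)))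

theorem dd_evol (hE : ∀ i, ContDiff ℝ ∞ (E i)) (hB : ∀ i, ContDiff ℝ ∞ (B i)) (a : ℝ × V3)
    (i : Fin 3) : dd a (evol E B i) = fun q =>
      dd (0, a) (kirDot (E i)) (0, q) + dd (0, a) (kir (crl B i)) (0, q) := by
  have h1 := contDiff_kirDot (hE i)
  have h2 := contDiff_kir (contDiff_crl hB i)
  unfold evol
  rw [dd_add_fun (contDiff_slice h1) (contDiff_slice h2), dd_slice h1, dd_slice h2]

theorem crl_evol (hE : ∀ i, ContDiff ℝ ∞ (E i)) (hB : ∀ i, ContDiff ℝ ∞ (B i)) (i : Fin 3)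
    (q : ℝ × V3) :
    crl (evol E B) i q = kirDot (crl E i) (0, q) + kir (crl (crl B) i) (0, q) := by
  have hcB := contDiff_crl hB
  have h1 : kirDot (crl E i) (0, q) = _ :=
    congrFun (kirDot_sub (contDiff_dd (hE _) _) (contDiff_dd (hE _) _)) (0, q)
  have h2 : kir (crl (crl B) i) (0, q) = _ :=
    congrFun (kir_sub (contDiff_dd (hcB _) _) (contDiff_dd (hcB _) _)) (0, q)
  rw [crl, dd_evol hE hB, dd_evol hE hB, h1, h2]
  simp only [dd_kirDot (hE _), dd_kir (hcB _)]
  ring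

theorem dvg_evol (hE : ∀ i, ContDiff ℝ ∞ (E i)) (hB : ∀ i, ContDiff ℝ ∞ (B i))
    (hdiv : ∀ q, dvg E q = 0) (q : ℝ × V3) : dvg (evol E B) q = 0 := by
  have hcB := contDiff_crl hB
  have h1 := kirDot_sum (fun i => contDiff_dd (hE i) (0, e i)) (0, q)
  have h2 := kir_sum (fun i => contDiff_dd (hcB i) (0, e i)) (0, q)
  rw [show (fun q => ∑ i, dd (0, e i) (E i) q) = fun _ => 0 from funext hdiv, kirDot_zero] at h1
  rw [show (fun q => ∑ i, dd (0, e i) (crl B i) q) = fun _ => 0 from funext (dvg_crl hB),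
    kir_zero] at h2
  simp only [dvg, dd_evol hE hB, dd_kirDot (hE _), dd_kir (hcB _), Finset.sum_add_distrib,
    ← h1, ← h2, add_zero]

theorem evol_neg (hE : ∀ i, ContDiff ℝ ∞ (E i)) (hB : ∀ i, ContDiff ℝ ∞ (B i)) :
    evol (fun i q => - E i q) (fun i q => - B i q) = fun i q => - evol E B i q := by
  funext i q
  have h : kirDot (fun q => - E i q) = fun p => - kirDot (E i) p := by
    rw [kirDot, kir_neg (hE i), dd_neg_fun, kirDot]
  simp only [evol, crl_neg, h, kir_neg (contDiff_crl hB i)]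
  ring

theorem dd_time_evol (hE : ∀ i, ContDiff ℝ ∞ (E i)) (hB : ∀ i, ContDiff ℝ ∞ (B i))
    (hdiv : ∀ q, dvg E q = 0) (i : Fin 3) (q : ℝ × V3) :
    dd (1, 0) (evol E B i) q = crl (evol B fun i q => - E i q) i q := by
  have hE' (j : Fin 3) : ContDiff ℝ ∞ fun q => - E j q := (hE j).neg
  have hc : crl (crl fun i q => - E i q) i = fun q => ∑ j, dd (0, e j) (dd (0, e j) (E i)) q := by
    funext q
    rw [crl_crl hE' (fun q => by rw [dvg_neg, hdiv, neg_zero])]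
    simp only [dd_neg_fun, Finset.sum_neg_distrib, neg_neg]
  rw [dd_evol hE hB, crl_evol hB hE', hc,
    kir_sum fun j => contDiff_dd (contDiff_dd (hE i) _) _]
  simp only [dd_radial_kirDot (hE i)]
  rw [add_comm]
  rfl

theorem evol_time_zero (hE : ∀ i, ContDiff ℝ ∞ (E i)) (i : Fin 3) (x : V3) :
    evol E B i (0, x) = E i (0, x) := by
  rw [evol, kirDot_radius_zero (hE i), kir_radius_zero, add_zero]

/-- A solution of Maxwell's equations is determined by its Cauchy data. -/
theorem eq_evol (hE : ∀ i, ContDiff ℝ ∞ (E i)) (hB : ∀ i, ContDiff ℝ ∞ (B i))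
    (hdiv : ∀ q, dvg E q = 0) (htE : ∀ i, dd (1, 0) (E i) = crl B i)
    (htB : ∀ i, dd (1, 0) (B i) = fun q => - crl E i q) (i : Fin 3) :
    E i = evol E B i := by
  funext ⟨t, x⟩
  have hcB := contDiff_crl hB i
  have hK := contDiff_kirDot (hE i)
  have hk := contDiff_kir hcB
  have hlap : dd (1, 0) (crl B i) = fun q => ∑ j, dd (0, e j) (dd (0, e j) (E i)) q := by
    funext q
    rw [dd_crl hB]
    simp only [htB]
    simp only [crl_neg, crl_crl hE hdiv, neg_neg]
  have hder (s : ℝ) : HasDerivAt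
      (fun s => kirDot (E i) (s, t - s, x) + kir (crl B i) (s, t - s, x)) 0 s := by
    have hl : HasDerivAt (fun s : ℝ => (s, t - s, x)) ((1, 0, 0) - (0, 1, 0)) s := by
      simpa using (hasDerivAt_id s).prodMk
        (((hasDerivAt_id s).const_sub t).prodMk (hasDerivAt_const s x))
    refine ((hasDerivAt_comp_line hK hl).fun_add (hasDerivAt_comp_line hk hl)).congr_deriv ?_
    rw [dd_sub_dir, dd_sub_dir, dd_kirDot (hE i) 1 0, dd_radial_kirDot (hE i), dd_kir hcB 1 0,
      hlap, kir_sum fun j => contDiff_dd (contDiff_dd (hE i) _) _, htE]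
    simp only [kirDot]
    ring
  have h := is_const_of_deriv_eq_zero (fun s => (hder s).differentiableAt)
    (fun s => (hder s).deriv) t 0
  simpa [kirDot_radius_zero (hE i), kir_radius_zero, evol] using h

theorem evol_congr {E' B' : Fin 3 → ℝ × V3 → ℝ} (hE : ∀ i, ContDiff ℝ ∞ (E i))
    (hB : ∀ i, ContDiff ℝ ∞ (B i)) (hE' : ∀ i, ContDiff ℝ ∞ (E' i))
    (hB' : ∀ i, ContDiff ℝ ∞ (B' i)) (h : ∀ i x, E i (0, x) = E' i (0, x))
    (h' : ∀ i x, B i (0, x) = B' i (0, x)) (i : Fin 3) : evol E B i = evol E' B' i := by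
  funext ⟨t, x⟩
  rw [evol, evol, kirDot_congr (hE i) (hE' i) (h i), kir_congr (crl_congr hB hB' h' i)]

end Evolution

section Solution

variable {E B E' B' : ℝ × V3 → V3}

/-- The smooth solutions of the vacuum Maxwell equations. -/
structure IsSolution (E B : ℝ × V3 → V3) : Prop where
  contDiff_fst : ContDiff ℝ ∞ E
  contDiff_snd : ContDiff ℝ ∞ B
  div_snd : ∀ q, div3 B q = 0
  div_fst : ∀ q, div3 E q = 0
  time_snd : ∀ q, tdVec B q = - curl3 E q
  time_fst : ∀ q, tdVec E q = curl3 B q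

theorem curl3_neg (hV : ContDiff ℝ ∞ E) (q : ℝ × V3) :
    curl3 (fun q => - E q) q = - curl3 E q := by
  rw [curl3_eq_crl hV.neg, curl3_eq_crl hV]
  funext i
  exact congrFun (congrFun (crl_neg fun i q => E q i) i) q

/-- Electric-magnetic duality. -/
theorem IsSolution.dual (h : IsSolution E B) : IsSolution B (fun q => - E q) where
  contDiff_fst := h.contDiff_snd
  contDiff_snd := h.contDiff_fst.neg
  div_fst := h.div_snd
  div_snd q := by
    have h' := div3_eq_dvg h.contDiff_fst q
    rw [h.div_fst] at h'
    rw [div3_eq_dvg h.contDiff_fst.neg]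
    exact (dvg_neg _ q).trans (by rw [← h', neg_zero])
  time_fst q := by rw [h.time_snd, curl3_neg h.contDiff_fst]
  time_snd q := by
    rw [← h.time_fst]
    exact deriv.fun_neg

theorem IsSolution.fst_eq_evol (h : IsSolution E B) (i : Fin 3) :
    (fun q => E q i) = evol (fun i q => E q i) (fun i q => B q i) i := by
  have hE := h.contDiff_fst
  have hB := h.contDiff_snd
  refine eq_evol (contDiff_pi.1 hE) (contDiff_pi.1 hB)
    (fun q => (div3_eq_dvg hE q).symm.trans (h.div_fst q)) (fun j => funext fun q => ?_)
    (fun j => funext fun q => ?_) i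
  · have := h.time_fst q
    rw [tdVec_eq_dd hE, curl3_eq_crl hB] at this
    exact congrFun this j
  · have := h.time_snd q
    rw [tdVec_eq_dd hB, curl3_eq_crl hE] at this
    exact congrFun this j

theorem IsSolution.fst_unique (h : IsSolution E B) (h' : IsSolution E' B')
    (hE : ∀ x, E (0, x) = E' (0, x)) (hB : ∀ x, B (0, x) = B' (0, x)) : E = E' := by
  funext q i
  have := (h.fst_eq_evol i).trans ((evol_congr (contDiff_pi.1 h.contDiff_fst)
    (contDiff_pi.1 h.contDiff_snd) (contDiff_pi.1 h'.contDiff_fst) (contDiff_pi.1 h'.contDiff_snd)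
    (fun i x => congrFun (hE x) i) (fun i x => congrFun (hB x) i) i).trans (h'.fst_eq_evol i).symm)
  exact congrFun this q

theorem exists_isSolution {E₀ B₀ : V3 → V3} (hE₀ : ContDiff ℝ ∞ E₀) (hB₀ : ContDiff ℝ ∞ B₀)
    (hdE : ∀ x, div30 E₀ x = 0) (hdB : ∀ x, div30 B₀ x = 0) :
    ∃ E B, IsSolution E B ∧ (∀ x, E (0, x) = E₀ x) ∧ ∀ x, B (0, x) = B₀ x := by
  have hE' : ContDiff ℝ ∞ fun q : ℝ × V3 => E₀ q.2 := by fun_prop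
  have hB' : ContDiff ℝ ∞ fun q : ℝ × V3 => B₀ q.2 := by fun_prop
  set u : Fin 3 → ℝ × V3 → ℝ := fun i q => E₀ q.2 i
  set v : Fin 3 → ℝ × V3 → ℝ := fun i q => B₀ q.2 i
  have hu : ∀ i, ContDiff ℝ ∞ (u i) := contDiff_pi.1 hE'
  have hv : ∀ i, ContDiff ℝ ∞ (v i) := contDiff_pi.1 hB'
  have hu' (i : Fin 3) : ContDiff ℝ ∞ fun q => - u i q := (hu i).neg
  have hdu (q : ℝ × V3) : dvg u q = 0 := (div3_eq_dvg hE' q).symm.trans (hdE q.2)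
  have hdv (q : ℝ × V3) : dvg v q = 0 := (div3_eq_dvg hB' q).symm.trans (hdB q.2)
  have hE : ContDiff ℝ ∞ fun q i => evol u v i q := contDiff_pi.2 (contDiff_evol hu hv)
  have hB : ContDiff ℝ ∞ fun q i => evol v (fun i q => - u i q) i q :=
    contDiff_pi.2 (contDiff_evol hv hu')
  refine ⟨fun q i => evol u v i q, fun q i => evol v (fun i q => - u i q) i q,
    ⟨hE, hB, fun q => ?_, fun q => ?_, fun q => ?_, fun q => ?_⟩,
    fun x => funext fun i => evol_time_zero hu i x, fun x => funext fun i => evol_time_zero hv i x⟩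
  · exact (div3_eq_dvg hB q).trans (dvg_evol hv hu' hdv q)
  · exact (div3_eq_dvg hE q).trans (dvg_evol hu hv hdu q)
  · rw [tdVec_eq_dd hB, curl3_eq_crl hE]
    funext i
    refine (dd_time_evol hv hu' hdv i q).trans ?_
    rw [evol_neg hu hv, crl_neg]
    rfl
  · rw [tdVec_eq_dd hE, curl3_eq_crl hB]
    exact funext fun i => dd_time_evol hu hv hdu i q

end Solution

end Maxwell

/-- Restriction to the Cauchy surface `{t = 0}` is a bijection from the set of pairs of smooth
time-dependent vector fields `(E, B)` on `ℝ × ℝ³` satisfying the vacuum Maxwell equations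
(`div B = 0`, `div E = 0`, `∂ₜB = -curl E`, `∂ₜE = curl B` everywhere) onto the set of
pairs of smooth vector fields `(E₀, B₀)` on `ℝ³` satisfying only the Gauß constraints
`div E₀ = 0` and `div B₀ = 0`.  (Theorem 2.2 of the paper for vacuum Maxwell theory.) -/
theorem maxwell_solutions_bijective_to_cauchy_data :
    Set.BijOn
      (fun EB : (ℝ × V3 → V3) × (ℝ × V3 → V3) =>
        ((fun x : V3 => EB.1 (0, x)), (fun x : V3 => EB.2 (0, x))))
      {EB : (ℝ × V3 → V3) × (ℝ × V3 → V3) |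
        ContDiff ℝ (⊤ : ℕ∞) EB.1 ∧ ContDiff ℝ (⊤ : ℕ∞) EB.2 ∧
        (∀ q : ℝ × V3, div3 EB.2 q = 0) ∧
        (∀ q : ℝ × V3, div3 EB.1 q = 0) ∧
        (∀ q : ℝ × V3, tdVec EB.2 q = -curl3 EB.1 q) ∧
        (∀ q : ℝ × V3, tdVec EB.1 q = curl3 EB.2 q)}
      {EB₀ : (V3 → V3) × (V3 → V3) |
        ContDiff ℝ (⊤ : ℕ∞) EB₀.1 ∧ ContDiff ℝ (⊤ : ℕ∞) EB₀.2 ∧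
        (∀ x : V3, div30 EB₀.1 x = 0) ∧
        (∀ x : V3, div30 EB₀.2 x = 0)} := by
  open Maxwell in
  refine ⟨?_, ?_, ?_⟩
  · rintro ⟨E, B⟩ ⟨hE, hB, hdB, hdE, -, -⟩
    exact ⟨hE.comp (by fun_prop), hB.comp (by fun_prop), fun x => hdE (0, x), fun x => hdB (0, x)⟩
  · rintro ⟨E, B⟩ ⟨hE, hB, hdB, hdE, htB, htE⟩ ⟨E', B'⟩ ⟨hE', hB', hdB', hdE', htB', htE'⟩ heq
    have h : IsSolution E B := ⟨hE, hB, hdB, hdE, htB, htE⟩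
    have h' : IsSolution E' B' := ⟨hE', hB', hdB', hdE', htB', htE'⟩
    have h0E (x : V3) : E (0, x) = E' (0, x) := congrFun (congrArg Prod.fst heq) x
    have h0B (x : V3) : B (0, x) = B' (0, x) := congrFun (congrArg Prod.snd heq) x
    exact Prod.ext (h.fst_unique h' h0E h0B)
      (h.dual.fst_unique h'.dual h0B fun x => congrArg Neg.neg (h0E x))
  · rintro ⟨E₀, B₀⟩ ⟨hE₀, hB₀, hdE, hdB⟩
    obtain ⟨E, B, h, h0E, h0B⟩ := exists_isSolution hE₀ hB₀ hdE hdB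
    exact ⟨(E, B), ⟨h.contDiff_fst, h.contDiff_snd, h.div_snd, h.div_fst, h.time_snd, h.time_fst⟩,
      Prod.ext (funext h0E) (funext h0B)⟩
end

section
/- Let B₄, B₇, e₃, e₆ be smooth time-dependent forms on ℝ^{10} of degrees 4, 7, 3, 6 respectively, satisfying ∂_tB₄ = d e₃ and ∂_tB₇ = d e₆ − B₄ ∧ e₃ at every point of ℝ × ℝ^{10}, and suppose the C-field Gauß laws hold on the Cauchy surface {t = 0}: dB₄(0,·) = 0 and dB₇(0,·) = −½ (B₄ ∧ B₄)(0,·). Then the Gauß laws hold on all of ℝ × ℝ^{10}: dB₄(t,·) = 0 and dB₇(t,·) = −½ (B₄ ∧ B₄)(t,·) for every t. (Lemma 2.1 of the paper — the higher Gauß law is a first-class constraint — for the genuinely non-linear case of the C-field of 11d supergravity, whose Gauß law is governed by the quadratic source P₇(B) = −½ B₄ ∧ B₄.) -/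
open scoped BigOperators

/-- The spatial model space `ℝ^d`. -/
abbrev Vec (d : ℕ) : Type := Fin d → ℝ

/-- The space of alternating `p`-linear maps `(ℝ^d)^p → ℝ`. -/
abbrev AltForm (d p : ℕ) : Type := AlternatingMap ℝ (Vec d) ℝ (Fin p)

/-- A time-dependent `p`-form on `ℝ^d`: a map `ℝ × ℝ^d → (ℝ^d [⋀^p]→ ℝ)`. -/
abbrev TForm (d p : ℕ) : Type := ℝ × Vec d → AltForm d p

/-- A "raw" time-dependent `p`-form: a point of `ℝ × ℝ^d` together with a `p`-tuple
of vectors is assigned a number. -/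
abbrev RawForm (d p : ℕ) : Type := ℝ × Vec d → (Fin p → Vec d) → ℝ

/-- The raw form underlying a time-dependent `p`-form. -/
def TForm.raw {d p : ℕ} (ω : TForm d p) : RawForm d p := fun q v => ω q v

/-- A time-dependent `p`-form is smooth iff all its evaluations (at `p`-tuples of vectors,
which are linear coordinates on the finite-dimensional space of alternating `p`-linear maps)
are smooth functions of `(t, x)`. -/
def TForm.Smooth {d p : ℕ} (ω : TForm d p) : Prop :=
  ∀ v : Fin p → Vec d, ContDiff ℝ (⊤ : ℕ∞) fun q : ℝ × Vec d => ω q v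

/-- The time derivative `∂ₜω` of a (raw) time-dependent form, evaluation-wise. -/
noncomputable def tder {d p : ℕ} (ω : RawForm d p) : RawForm d p :=
  fun q v => deriv (fun s : ℝ => ω (s, q.2) v) q.1

/-- The spatial exterior derivative `dω` of a (raw) time-dependent `p`-form:
`(dω)(t,x)(v₀,…,v_p) = ∑ i, (-1)^i (D_x ω(t,·)(x) vᵢ)(v₀,…,v̂ᵢ,…,v_p)`. -/
noncomputable def sder {d p : ℕ} (ω : RawForm d p) : RawForm d (p + 1) :=
  fun q v => ∑ i : Fin (p + 1),
    (-1 : ℝ) ^ (i : ℕ) *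
      fderiv ℝ (fun x : Vec d => ω (q.1, x) (v ∘ i.succAbove)) q.2 (v i)

/-- The wedge product of alternating maps (the alternatization of the tensor product,
with the `(p+q)!/(p!q!)` normalization, i.e. without division). -/
noncomputable def wedge {V : Type*} [AddCommGroup V] [Module ℝ V] {p q : ℕ}
    (α : AlternatingMap ℝ V ℝ (Fin p)) (β : AlternatingMap ℝ V ℝ (Fin q)) :
    AlternatingMap ℝ V ℝ (Fin (p + q)) :=
  ((LinearMap.mul' ℝ ℝ).compAlternatingMap (α.domCoprod β)).domDomCongr finSumFinEquiv



section AntisymmetricSums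

open Equiv

variable {V : Type*} {n p q : ℕ}

theorem sum_sign_mul_right (F : Perm (Fin n) → ℝ) (c : Perm (Fin n)) :
    ∑ σ, ((Perm.sign σ : ℤ) : ℝ) * F (σ * c) =
      ((Perm.sign c : ℤ) : ℝ) * ∑ σ, ((Perm.sign σ : ℤ) : ℝ) * F σ := by
  rw [← Equiv.sum_comp (Equiv.mulRight c) fun σ => ((Perm.sign σ : ℤ) : ℝ) * F σ, Finset.mul_sum]
  refine Finset.sum_congr rfl fun σ _ => ?_
  have hc : ((Perm.sign c : ℤ) : ℝ) * ((Perm.sign c : ℤ) : ℝ) = 1 := by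
    exact_mod_cast Int.units_coe_mul_self (Perm.sign c)
  simp only [Equiv.coe_mulRight, Perm.sign_mul, Units.val_mul, Int.cast_mul]
  linear_combination (-((Perm.sign σ : ℤ) : ℝ) * F (σ * c)) * hc

/-- Expansion of an antisymmetrized sum over `Perm (Fin (n + 1))` along the image of `0`. -/
theorem sum_neg_one_pow_sum_sign_succAbove (G : Fin (n + 1) → (Fin n → Fin (n + 1)) → ℝ) :
    ∑ i : Fin (n + 1), (-1 : ℝ) ^ (i : ℕ) *
        ∑ σ : Perm (Fin n), ((Perm.sign σ : ℤ) : ℝ) * G i (fun j => i.succAbove (σ j)) =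
      ∑ τ : Perm (Fin (n + 1)), ((Perm.sign τ : ℤ) : ℝ) * G (τ 0) (fun j => τ j.succ) := by
  let e : Fin (n + 1) × Perm (Fin n) → Perm (Fin (n + 1)) := fun x =>
    x.1.cycleRange.symm * Perm.decomposeFin.symm (0, x.2)
  have he0 (x) : e x 0 = x.1 := by simp [e]
  have heS (x) (j : Fin n) : e x j.succ = x.1.succAbove (x.2 j) := by simp [e]
  have hsign (x) : ((Perm.sign (e x) : ℤ) : ℝ) =
      (-1 : ℝ) ^ (x.1 : ℕ) * ((Perm.sign x.2 : ℤ) : ℝ) := by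
    simp [e]
  have hinj : Function.Injective e := by
    rintro ⟨i, σ⟩ ⟨i', σ'⟩ h
    obtain rfl : i = i' := by simpa only [he0] using congrArg (fun f => f 0) h
    have : σ = σ' := by
      ext1 j
      apply Fin.succAbove_right_injective (p := i)
      rw [← heS (i, σ), h, heS]
    rw [this]
  have hbij : Function.Bijective e := by
    rw [Fintype.bijective_iff_injective_and_card]
    exact ⟨hinj, by simp [Fintype.card_perm, Nat.factorial_succ]⟩
  rw [← hbij.sum_comp, Fintype.sum_prod_type]
  refine Finset.sum_congr rfl fun i _ => ?_
  rw [Finset.mul_sum]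
  refine Finset.sum_congr rfl fun σ _ => ?_
  simp only [hsign, he0, heS]
  ring

/-- The alternating sum `∑ i, (-1)^i T (v i) (v₀,…,v̂ᵢ,…,vₙ)`. -/
def altUncurry (T : V → (Fin n → V) → ℝ) (v : Fin (n + 1) → V) : ℝ :=
  ∑ i : Fin (n + 1), (-1 : ℝ) ^ (i : ℕ) * T (v i) (v ∘ i.succAbove)

/-- The alternating sum over all permutations of the product of two functions of tuples. -/
def wedgeSum (α : (Fin p → V) → ℝ) (β : (Fin q → V) → ℝ) (v : Fin (p + q) → V) : ℝ :=
  ∑ σ : Perm (Fin (p + q)), ((Perm.sign σ : ℤ) : ℝ) *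
    (α (fun i => v (σ (Fin.castAdd q i))) * β (fun j => v (σ (Fin.natAdd p j))))

theorem altUncurry_wedgeSum_right (α : (Fin p → V) → ℝ) (S : V → (Fin q → V) → ℝ)
    (v : Fin (p + q + 1) → V) :
    ((q : ℝ) + 1) * altUncurry (fun w => wedgeSum α (S w)) v =
      (-1 : ℝ) ^ p * wedgeSum (q := q + 1) α (altUncurry S) v := by
  have hL : altUncurry (fun w => wedgeSum α (S w)) v = _ :=
    sum_neg_one_pow_sum_sign_succAbove (n := p + q) fun i f =>
      α (fun k => v (f (Fin.castAdd q k))) * S (v i) (fun k => v (f (Fin.natAdd p k)))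
  have hterm (i : Fin (q + 1)) :
      ∑ τ : Perm (Fin (p + (q + 1))), ((Perm.sign τ : ℤ) : ℝ) *
        (α (fun k => v (τ (Fin.castAdd (q + 1) k))) *
          S (v (τ (Fin.natAdd p i))) (fun k => v (τ (Fin.natAdd p (i.succAbove k))))) =
      (-1 : ℝ) ^ (p + i : ℕ) * altUncurry (fun w => wedgeSum α (S w)) v := by
    let I : Fin (p + q + 1) := Fin.natAdd p i
    have h1 (k : Fin p) : I.cycleRange (Fin.castAdd (q + 1) k) = (Fin.castAdd q k).succ := by
      rw [← Fin.cycleRange_succAbove I, Fin.succAbove_of_castSucc_lt]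
      · rfl
      · simp only [I, Fin.lt_def, Fin.val_natAdd, Fin.val_castSucc, Fin.val_castAdd]
        omega
    have h2 (k : Fin q) :
        I.cycleRange (Fin.natAdd p (i.succAbove k)) = (Fin.natAdd p k).succ := by
      rw [← Fin.cycleRange_succAbove I]
      congr 1
      ext
      simp only [I, Fin.succAbove, Fin.lt_def, Fin.val_natAdd, Fin.val_castSucc]
      split_ifs <;> simp <;> omega
    have h0 : I.cycleRange (Fin.natAdd p i) = 0 := Fin.cycleRange_self I
    have h := sum_sign_mul_right (n := p + q + 1) (fun τ =>
      α (fun k => v (τ (Fin.castAdd (q + 1) k))) *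
        S (v (τ (Fin.natAdd p i))) (fun k => v (τ (Fin.natAdd p (i.succAbove k))))) I.cycleRange
    simp only [Perm.mul_apply, h1, h2, h0, Fin.sign_cycleRange] at h
    rw [hL, h, ← mul_assoc]
    simp [I, ← mul_pow]
    rfl
  have hexp : wedgeSum (q := q + 1) α (altUncurry S) v =
      ∑ i : Fin (q + 1), (-1 : ℝ) ^ (i : ℕ) *
        ∑ τ : Perm (Fin (p + (q + 1))), ((Perm.sign τ : ℤ) : ℝ) *
          (α (fun k => v (τ (Fin.castAdd (q + 1) k))) *
            S (v (τ (Fin.natAdd p i))) (fun k => v (τ (Fin.natAdd p (i.succAbove k))))) := by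
    simp only [wedgeSum, altUncurry, Finset.mul_sum]
    rw [Finset.sum_comm]
    refine Finset.sum_congr rfl fun i _ => Finset.sum_congr rfl fun τ _ => ?_
    simp only [Function.comp_def]
    ring
  rw [hexp]
  simp_rw [hterm]
  simp only [← mul_assoc, ← pow_add, ← Finset.sum_mul, Finset.mul_sum]
  have hone (i : Fin (q + 1)) : (-1 : ℝ) ^ (p + ((i : ℕ) + (p + i))) = 1 :=
    Even.neg_one_pow ⟨p + i, by ring⟩
  simp [hone]

theorem altUncurry_wedgeSum_left_eq_zero {T : V → (Fin p → V) → ℝ} (β : (Fin q → V) → ℝ)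
    (hT : ∀ w, altUncurry T w = 0) (v : Fin (p + q + 1) → V) :
    altUncurry (fun w => wedgeSum (T w) β) v = 0 := by
  have hL : altUncurry (fun w => wedgeSum (T w) β) v = _ :=
    sum_neg_one_pow_sum_sign_succAbove (n := p + q) fun i f =>
      T (v i) (fun k => v (f (Fin.castAdd q k))) * β (fun k => v (f (Fin.natAdd p k)))
  have hpq : p + 1 ≤ p + q + 1 := by omega
  have hterm (i : Fin (p + 1)) :
      ∑ τ : Perm (Fin (p + q + 1)), ((Perm.sign τ : ℤ) : ℝ) *
        (T (v (τ (Fin.castLE hpq i))) (fun k => v (τ (Fin.castLE hpq (i.succAbove k)))) *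
          β (fun k => v (τ (Fin.natAdd p k).succ))) =
      (-1 : ℝ) ^ (i : ℕ) * altUncurry (fun w => wedgeSum (T w) β) v := by
    let I : Fin (p + q + 1) := Fin.castLE hpq i
    have h1 (k : Fin p) :
        I.cycleRange (Fin.castLE hpq (i.succAbove k)) = (Fin.castAdd q k).succ := by
      rw [← Fin.cycleRange_succAbove I]
      congr 1
      ext
      simp only [I, Fin.succAbove, Fin.lt_def, Fin.val_castLE, Fin.val_castSucc, Fin.val_castAdd]
      split_ifs <;> simp
    have h2 (k : Fin q) : I.cycleRange (Fin.natAdd p k).succ = (Fin.natAdd p k).succ := by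
      apply Fin.cycleRange_of_gt
      simp only [I, Fin.lt_def, Fin.val_castLE, Fin.val_succ, Fin.val_natAdd]
      omega
    have h0 : I.cycleRange (Fin.castLE hpq i) = 0 := Fin.cycleRange_self I
    have h := sum_sign_mul_right (n := p + q + 1) (fun τ =>
      T (v (τ (Fin.castLE hpq i))) (fun k => v (τ (Fin.castLE hpq (i.succAbove k)))) *
        β (fun k => v (τ (Fin.natAdd p k).succ))) I.cycleRange
    simp only [Perm.mul_apply, h1, h2, h0, Fin.sign_cycleRange] at h
    rw [hL, h, ← mul_assoc]
    simp [I, ← mul_pow]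
  have hexp : (0 : ℝ) = ∑ i : Fin (p + 1), (-1 : ℝ) ^ (i : ℕ) *
      ∑ τ : Perm (Fin (p + q + 1)), ((Perm.sign τ : ℤ) : ℝ) *
        (T (v (τ (Fin.castLE hpq i))) (fun k => v (τ (Fin.castLE hpq (i.succAbove k)))) *
          β (fun k => v (τ (Fin.natAdd p k).succ))) := by
    simp only [Finset.mul_sum]
    rw [Finset.sum_comm]
    refine (Finset.sum_eq_zero fun τ _ => ?_).symm
    have h := hT fun k => v (τ (Fin.castLE hpq k))
    simp only [altUncurry, Function.comp_def] at h
    rw [← mul_zero (((Perm.sign τ : ℤ) : ℝ) * β (fun k => v (τ (Fin.natAdd p k).succ))), ← h,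
      Finset.mul_sum]
    exact Finset.sum_congr rfl fun i _ => by ring
  simp_rw [hterm] at hexp
  simp only [← mul_assoc, ← pow_add, ← two_mul, pow_mul] at hexp
  simp only [neg_one_sq, one_pow, one_mul, Finset.sum_const, Finset.card_univ, Fintype.card_fin,
    nsmul_eq_mul] at hexp
  exact (mul_eq_zero.mp hexp.symm).resolve_left (by positivity)

/-- Two-fold alternating sums of a symmetric expression vanish. -/
theorem altUncurry_altUncurry_eq_zero {V : Type*} (S : V → V → (Fin n → V) → ℝ)
    (hS : ∀ a b w, S a b w = S b a w) (v : Fin (n + 2) → V) :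
    altUncurry (fun a => altUncurry (S a)) v = 0 := by
  simp only [altUncurry, Finset.mul_sum]
  rw [← Fintype.sum_prod_type']
  refine Finset.sum_involution (fun x _ => (x.1.succAbove x.2, x.2.predAbove x.1)) ?_ ?_ ?_ ?_
  · rintro ⟨i, j⟩ -
    have h := Fin.neg_one_pow_succAbove_add_predAbove (R := ℝ) i j
    simp only [Function.comp_def, Fin.succAbove_succAbove_predAbove,
      Fin.succAbove_succAbove_succAbove_predAbove] at *
    rw [hS (v (i.succAbove j)), ← mul_assoc, ← mul_assoc, ← pow_add, ← pow_add, h]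
    ring
  · rintro ⟨i, j⟩ - - h
    exact Fin.succAbove_ne i j (congrArg Prod.fst h)
  · simp
  · rintro ⟨i, j⟩ -
    have h : (i.succAbove j).succAbove (j.predAbove i) = i := Fin.succAbove_succAbove_predAbove i j
    refine Prod.ext h ?_
    apply Fin.succAbove_right_injective (p := i)
    have h' := Fin.succAbove_succAbove_predAbove (i.succAbove j) (j.predAbove i)
    rwa [h] at h'

theorem wedgeSum_comm_four (α β : (Fin 4 → V) → ℝ) (v : Fin (4 + 4) → V) :
    wedgeSum α β v = wedgeSum β α v := by
  have h := sum_sign_mul_right (n := 4 + 4) (fun σ =>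
    (β (fun i => v (σ (Fin.castAdd 4 i))) * α (fun j => v (σ (Fin.natAdd 4 j)))))
    (finRotate 8 ^ 4)
  have h1 (k : Fin 4) : (finRotate 8 ^ 4) (Fin.castAdd 4 k) = Fin.natAdd 4 k := by
    revert k; decide
  have h2 (k : Fin 4) : (finRotate 8 ^ 4) (Fin.natAdd 4 k) = Fin.castAdd 4 k := by
    revert k; decide
  have hs : Perm.sign (finRotate 8 ^ 4) = 1 := by
    rw [map_pow, sign_finRotate]; rfl
  simp only [Perm.mul_apply, h1, h2, hs] at h
  simp only [wedgeSum]
  simpa [mul_comm] using h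

theorem factorial_mul_wedge [AddCommGroup V] [Module ℝ V]
    (α : AlternatingMap ℝ V ℝ (Fin p)) (β : AlternatingMap ℝ V ℝ (Fin q)) (v : Fin (p + q) → V) :
    ((p.factorial : ℝ) * q.factorial) * wedge α β v = wedgeSum α β v := by
  have h := congrArg (fun f => LinearMap.mul' ℝ ℝ (f (v ∘ finSumFinEquiv)))
    (MultilinearMap.domCoprod_alternization_eq α β)
  have hw : wedge α β v = LinearMap.mul' ℝ ℝ (α.domCoprod β (v ∘ finSumFinEquiv)) := rfl
  simp only [MultilinearMap.alternatization_apply, Fintype.card_fin, AlternatingMap.smul_apply,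
    map_nsmul, map_sum] at h
  rw [← hw, nsmul_eq_mul, Nat.cast_mul] at h
  rw [← h, wedgeSum, ← (finSumFinEquiv (m := p) (n := q)).permCongr.sum_comp]
  refine Finset.sum_congr rfl fun σ _ => ?_
  rw [Units.smul_def, map_zsmul, zsmul_eq_mul]
  simp

end AntisymmetricSums

section Derivatives

variable {E : Type*} [NormedAddCommGroup E] [NormedSpace ℝ E]

theorem ContDiff.fderiv_apply_const {f : E → ℝ} (hf : ContDiff ℝ (⊤ : ℕ∞) f) (a : E) :
    ContDiff ℝ (⊤ : ℕ∞) fun q => fderiv ℝ f q a :=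
  (hf.fderiv_right (by simp)).clm_apply contDiff_const

theorem ContDiff.fderiv_fderiv_comm {f : E → ℝ} (hf : ContDiff ℝ (⊤ : ℕ∞) f) (a b q : E) :
    fderiv ℝ (fun q => fderiv ℝ f q a) q b = fderiv ℝ (fun q => fderiv ℝ f q b) q a := by
  have hd : DifferentiableAt ℝ (fderiv ℝ f) q :=
    (hf.fderiv_right (m := (⊤ : ℕ∞)) (by simp)).differentiable (by simp) q
  have hs : IsSymmSndFDerivAt ℝ f q := hf.contDiffAt.isSymmSndFDerivAt
    (by rw [minSmoothness_of_isRCLikeNormedField]; exact WithTop.coe_le_coe.mpr le_top)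
  rw [fderiv_clm_apply hd (differentiableAt_const a), fderiv_clm_apply hd (differentiableAt_const b)]
  simpa using hs b a

theorem deriv_slice {f : ℝ × E → ℝ} {q : ℝ × E} (hf : DifferentiableAt ℝ f q) :
    deriv (fun s => f (s, q.2)) q.1 = fderiv ℝ f q (1, 0) := by
  have h : HasDerivAt (fun s : ℝ => (s, q.2)) ((1 : ℝ), (0 : E)) q.1 :=
    (hasDerivAt_id _).prodMk (hasDerivAt_const _ _)
  exact (hf.hasFDerivAt.comp_hasDerivAt q.1 h).deriv

theorem fderiv_slice {f : ℝ × E → ℝ} {q : ℝ × E} (hf : DifferentiableAt ℝ f q) (w : E) :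
    fderiv ℝ (fun x => f (q.1, x)) q.2 w = fderiv ℝ f q (0, w) := by
  have h : HasFDerivAt (fun x : E => (q.1, x)) (ContinuousLinearMap.inr ℝ ℝ E) q.2 :=
    hasFDerivAt_prodMk_right _ _
  exact (congrArg (· w) (HasFDerivAt.comp q.2 hf.hasFDerivAt h).fderiv).trans <| by
    rw [ContinuousLinearMap.comp_apply, ContinuousLinearMap.inr_apply]

end Derivatives

section Forms

variable {d n p q : ℕ}

/-- A raw form is smooth if all its evaluations are. -/
def RawForm.Smooth (ω : RawForm d p) : Prop :=
  ∀ v : Fin p → Vec d, ContDiff ℝ (⊤ : ℕ∞) fun x => ω x v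

/-- The evaluation-wise derivative of a raw form in a space-time direction. -/
noncomputable def RawForm.dirDeriv (a : ℝ × Vec d) (ω : RawForm d p) : RawForm d p :=
  fun x v => fderiv ℝ (fun y => ω y v) x a

theorem RawForm.Smooth.differentiableAt {ω : RawForm d p} (hω : ω.Smooth) (v : Fin p → Vec d)
    (x : ℝ × Vec d) : DifferentiableAt ℝ (fun y => ω y v) x :=
  (hω v).differentiable (by simp) x

theorem RawForm.Smooth.dirDeriv {ω : RawForm d p} (hω : ω.Smooth) (a : ℝ × Vec d) :
    (ω.dirDeriv a).Smooth :=
  fun v => (hω v).fderiv_apply_const a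

theorem RawForm.Smooth.dirDeriv_comm {ω : RawForm d p} (hω : ω.Smooth) (a b : ℝ × Vec d) :
    (ω.dirDeriv a).dirDeriv b = (ω.dirDeriv b).dirDeriv a := by
  ext x v
  exact (hω v).fderiv_fderiv_comm a b x

theorem RawForm.Smooth.tder_eq {ω : RawForm d p} (hω : ω.Smooth) : tder ω = ω.dirDeriv (1, 0) := by
  ext x v
  exact deriv_slice (hω.differentiableAt v x)

theorem RawForm.Smooth.sder_eq {ω : RawForm d p} (hω : ω.Smooth) (x : ℝ × Vec d) :
    sder ω x = altUncurry fun w => ω.dirDeriv (0, w) x := by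
  ext v
  exact Finset.sum_congr rfl fun i _ => by
    rw [fderiv_slice (hω.differentiableAt _ x)]; rfl

theorem RawForm.Smooth.sder {ω : RawForm d p} (hω : ω.Smooth) : (sder ω).Smooth := by
  intro v
  simp only [hω.sder_eq, altUncurry]
  exact ContDiff.sum fun i _ => contDiff_const.mul (hω.dirDeriv _ _)

theorem RawForm.Smooth.dirDeriv_sder {ω : RawForm d p} (hω : ω.Smooth) (a : ℝ × Vec d) :
    (_root_.sder ω).dirDeriv a = _root_.sder (ω.dirDeriv a) := by
  ext x v
  rw [(hω.dirDeriv a).sder_eq]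
  change fderiv ℝ (fun y => _root_.sder ω y v) x a = _
  simp only [hω.sder_eq, altUncurry]
  rw [fderiv_fun_sum fun i _ => ((hω.dirDeriv _).differentiableAt _ x).const_mul _]
  simp only [sum_apply]
  refine Finset.sum_congr rfl fun i _ => ?_
  rw [fderiv_const_mul ((hω.dirDeriv _).differentiableAt _ x)]
  exact congrArg (_ * ·) ((hω _).fderiv_fderiv_comm _ _ x)

theorem RawForm.Smooth.sder_sder {ω : RawForm d p} (hω : ω.Smooth) :
    _root_.sder (_root_.sder ω) = 0 := by
  ext x v
  rw [hω.sder.sder_eq]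
  simp only [hω.dirDeriv_sder, (hω.dirDeriv _).sder_eq]
  exact altUncurry_altUncurry_eq_zero (fun a b => (ω.dirDeriv (0, a)).dirDeriv (0, b) x)
    (fun a b w => by rw [hω.dirDeriv_comm]) v

theorem RawForm.Smooth.sub {ω η : RawForm d p} (hω : ω.Smooth) (hη : η.Smooth) :
    RawForm.Smooth (ω - η) :=
  fun v => (hω v).sub (hη v)

theorem RawForm.Smooth.smul {ω : RawForm d p} (hω : ω.Smooth) (c : ℝ) :
    RawForm.Smooth (c • ω) :=
  fun v => contDiff_const.mul (hω v)

theorem RawForm.Smooth.dirDeriv_sub {ω η : RawForm d p} (hω : ω.Smooth) (hη : η.Smooth)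
    (a : ℝ × Vec d) : RawForm.dirDeriv a (ω - η) = ω.dirDeriv a - η.dirDeriv a := by
  ext x v
  exact congrArg (· a) (fderiv_sub (hω.differentiableAt v x) (hη.differentiableAt v x))

theorem RawForm.Smooth.dirDeriv_smul {ω : RawForm d p} (hω : ω.Smooth) (c : ℝ)
    (a : ℝ × Vec d) : RawForm.dirDeriv a (c • ω) = c • ω.dirDeriv a := by
  ext x v
  exact congrArg (· a) (fderiv_const_mul (hω.differentiableAt v x) c)

theorem RawForm.Smooth.sder_sub {ω η : RawForm d p} (hω : ω.Smooth) (hη : η.Smooth) :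
    _root_.sder (ω - η) = _root_.sder ω - _root_.sder η := by
  ext x v
  simp [(hω.sub hη).sder_eq, hω.sder_eq, hη.sder_eq, hω.dirDeriv_sub hη, altUncurry, mul_sub]

theorem RawForm.Smooth.sder_smul {ω : RawForm d p} (hω : ω.Smooth) (c : ℝ) :
    _root_.sder (c • ω) = c • _root_.sder ω := by
  ext x v
  simp [(hω.smul c).sder_eq, hω.sder_eq, hω.dirDeriv_smul, altUncurry, Finset.mul_sum,
    mul_left_comm]

theorem RawForm.Smooth.wedgeSum {ω : RawForm d p} {η : RawForm d q} (hω : ω.Smooth)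
    (hη : η.Smooth) : RawForm.Smooth fun x => wedgeSum (ω x) (η x) :=
  fun _ => ContDiff.sum fun _ _ => contDiff_const.mul ((hω _).mul (hη _))

theorem RawForm.Smooth.dirDeriv_wedgeSum {ω : RawForm d p} {η : RawForm d q} (hω : ω.Smooth)
    (hη : η.Smooth) (a x : ℝ × Vec d) (v : Fin (p + q) → Vec d) :
    RawForm.dirDeriv a (fun x => _root_.wedgeSum (ω x) (η x)) x v =
      _root_.wedgeSum (ω.dirDeriv a x) (η x) v + _root_.wedgeSum (ω x) (η.dirDeriv a x) v := by
  simp only [RawForm.dirDeriv, _root_.wedgeSum]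
  have h (u w) : DifferentiableAt ℝ (fun y => ω y u * η y w) x :=
    (hω.differentiableAt u x).mul (hη.differentiableAt w x)
  rw [fderiv_fun_sum fun σ _ => (h _ _).const_mul _]
  simp only [sum_apply, ← Finset.sum_add_distrib]
  refine Finset.sum_congr rfl fun σ _ => ?_
  rw [fderiv_const_mul (h _ _),
    fderiv_fun_mul (hω.differentiableAt _ x) (hη.differentiableAt _ x)]
  simp
  ring

/-- Leibniz rule for the exterior derivative when the left factor is closed. -/
theorem RawForm.Smooth.sder_wedgeSum {ω : RawForm d p} {η : RawForm d q} (hω : ω.Smooth)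
    (hη : η.Smooth) {x : ℝ × Vec d} (hclosed : _root_.sder ω x = 0)
    (v : Fin (p + q + 1) → Vec d) :
    ((q : ℝ) + 1) * _root_.sder (fun x => _root_.wedgeSum (ω x) (η x)) x v =
      (-1 : ℝ) ^ p * _root_.wedgeSum (q := q + 1) (ω x) (_root_.sder η x) v := by
  rw [hω.sder_eq] at hclosed
  rw [hη.sder_eq, ← altUncurry_wedgeSum_right, (hω.wedgeSum hη).sder_eq]
  have hleft := altUncurry_wedgeSum_left_eq_zero (η x) (congrFun hclosed) v
  congr 1
  simp only [altUncurry] at hleft ⊢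
  simp only [hω.dirDeriv_wedgeSum hη, mul_add, Finset.sum_add_distrib, hleft, zero_add]

theorem RawForm.Smooth.eq_of_tder_eq {ω η : RawForm d p} (hω : ω.Smooth) (hη : η.Smooth)
    (h0 : ∀ x v, ω (0, x) v = η (0, x) v) (h : tder ω = tder η) : ω = η := by
  ext ⟨t, x⟩ v
  have hslice : Differentiable ℝ fun s : ℝ => (s, x) := by fun_prop
  have hd {ω : RawForm d p} (hω : ω.Smooth) : Differentiable ℝ fun s => ω (s, x) v :=
    ((hω v).differentiable (by simp)).comp hslice
  have hconst := is_const_of_deriv_eq_zero ((hd hω).sub (hd hη)) (fun s => by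
    rw [deriv_sub (hd hω s) (hd hη s), sub_eq_zero]
    exact congrFun₂ h (s, x) v) t 0
  simpa [h0, sub_eq_zero] using hconst

end Forms

/-- Let `B₄, B₇, e₃, e₆` be smooth time-dependent forms on `ℝ^{10}` of degrees `4, 7, 3, 6`
satisfying the duality-symmetric Faraday–Ampère evolution equations of 11d supergravity
`∂ₜB₄ = d e₃` and `∂ₜB₇ = d e₆ − B₄ ∧ e₃` everywhere, and suppose the C-field Gauß laws
hold on the Cauchy surface `{t = 0}`: `dB₄(0,·) = 0` and `dB₇(0,·) = −½ (B₄ ∧ B₄)(0,·)`.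
Then the Gauß laws hold on all of `ℝ × ℝ^{10}`.  (Lemma 2.1 of the paper for the C-field
of 11d supergravity, with quadratic source `P₇(B) = −½ B₄ ∧ B₄`.) -/
theorem cfield_gauss_first_class
    (B₄ : TForm 10 4) (B₇ : TForm 10 7) (e₃ : TForm 10 3) (e₆ : TForm 10 6)
    (hB₄ : B₄.Smooth) (hB₇ : B₇.Smooth) (he₃ : e₃.Smooth) (he₆ : e₆.Smooth)
    (hev₄ : ∀ (q : ℝ × Vec 10) (v : Fin 4 → Vec 10),
      tder B₄.raw q v = sder e₃.raw q v)
    (hev₇ : ∀ (q : ℝ × Vec 10) (v : Fin 7 → Vec 10),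
      tder B₇.raw q v = sder e₆.raw q v - wedge (B₄ q) (e₃ q) v)
    (hG₄ : ∀ (x : Vec 10) (v : Fin 5 → Vec 10), sder B₄.raw (0, x) v = 0)
    (hG₇ : ∀ (x : Vec 10) (v : Fin 8 → Vec 10),
      sder B₇.raw (0, x) v = -((2⁻¹ : ℝ) * wedge (B₄ (0, x)) (B₄ (0, x)) v)) :
    (∀ (t : ℝ) (x : Vec 10) (v : Fin 5 → Vec 10), sder B₄.raw (t, x) v = 0) ∧
    (∀ (t : ℝ) (x : Vec 10) (v : Fin 8 → Vec 10),
      sder B₇.raw (t, x) v = -((2⁻¹ : ℝ) * wedge (B₄ (t, x)) (B₄ (t, x)) v)) := by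
  have hB₄ : RawForm.Smooth B₄.raw := hB₄
  have hB₇ : RawForm.Smooth B₇.raw := hB₇
  have he₃ : RawForm.Smooth e₃.raw := he₃
  have he₆ : RawForm.Smooth e₆.raw := he₆
  have hwedge {p q : ℕ} (α : TForm 10 p) (β : TForm 10 q) :
      (fun x v => wedge (α x) (β x) v : RawForm 10 (p + q)) =
        ((p.factorial : ℝ) * q.factorial)⁻¹ • fun x => wedgeSum (α.raw x) (β.raw x) := by
    ext x v
    have h := factorial_mul_wedge (α x) (β x) v
    simp only [Pi.smul_apply, smul_eq_mul]
    rw [eq_inv_mul_iff_mul_eq₀ (by positivity)]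
    exact h
  have htB₄ : tder B₄.raw = sder e₃.raw := funext₂ hev₄
  have htB₇ : tder B₇.raw = sder e₆.raw - fun x v => wedge (B₄ x) (e₃ x) v := funext₂ hev₇
  have hzero : RawForm.Smooth (0 : RawForm 10 5) := fun v => contDiff_const
  have hclosed : sder B₄.raw = 0 := by
    refine hB₄.sder.eq_of_tder_eq hzero hG₄ ?_
    rw [hB₄.sder.tder_eq, hB₄.dirDeriv_sder, ← hB₄.tder_eq, htB₄, he₃.sder_sder, hzero.tder_eq]
    ext x v
    simp [RawForm.dirDeriv]
  refine ⟨fun t x v => by rw [hclosed]; rfl, fun t x v => ?_⟩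
  have hBB := hB₄.wedgeSum hB₄
  have hBe := hB₄.wedgeSum he₃
  let c : ℝ := -(2⁻¹ * ((Nat.factorial 4 : ℝ) * Nat.factorial 4)⁻¹)
  let P : RawForm 10 8 := c • fun x => wedgeSum (B₄.raw x) (B₄.raw x)
  have hP (x v) : P x v = -((2⁻¹ : ℝ) * wedge (B₄ x) (B₄ x) v) := by
    have h := congrFun₂ (hwedge B₄ B₄) x v
    simp only [Pi.smul_apply, smul_eq_mul] at h
    rw [h]
    simp only [P, c, Pi.smul_apply, smul_eq_mul]
    ring
  rw [← hP]
  refine congrFun₂ (hB₇.sder.eq_of_tder_eq (hBB.smul c) (fun x v => ?_) ?_) (t, x) v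
  · exact (hG₇ x v).trans (hP (0, x) v).symm
  · rw [hB₇.sder.tder_eq, hB₇.dirDeriv_sder, ← hB₇.tder_eq, htB₇, hwedge,
      he₆.sder.sder_sub (hBe.smul _), he₆.sder_sder, hBe.sder_smul, (hBB.smul c).tder_eq,
      hBB.dirDeriv_smul]
    ext x v
    have hleib := hB₄.sder_wedgeSum he₃ (congrFun hclosed x) v
    have hBBt := hB₄.dirDeriv_wedgeSum hB₄ (1, 0) x v
    rw [← hB₄.tder_eq, htB₄, wedgeSum_comm_four (sder e₃.raw x)] at hBBt
    simp only [Pi.sub_apply, Pi.zero_apply, Pi.smul_apply, smul_eq_mul]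
    rw [hBBt]
    norm_num [c, Nat.factorial] at hleib ⊢
    linarith
end
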